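/- Let (Ω, F, μ) be a probability space, let R, C be measurable sets, and let B_maj, B_min be measurable conditioning events such that for each d ∈ {maj, min}: μ(B_d) > 0, μ(C ∩ B_d) > 0, μ(Cᶜ ∩ B_d) > 0 and μ(R ∩ B_d) > 0. Assume: (parity in reporting) P[R ∣ C ∩ B_maj] = P[R ∣ C ∩ B_min] and P[R ∣ Cᶜ ∩ B_maj] = P[R ∣ Cᶜ ∩ B_min]; and (criminality independent of race given context) P[C ∣ B_maj] = P[C ∣ B_min]. Then predictive parity holds: P[C ∣ R ∩ B_maj] = P[C ∣ R ∩ B_min]. (This is the first conclusion of the paper's Appendix B lemma: parity in reporting leads to predictive parity.) -/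

import Mathlib

open MeasureTheory ProbabilityTheory Filter

/-- Conditional probability `P[A ∣ B] = μ(A ∩ B)/μ(B)` as a real number,
via Mathlib's `ProbabilityTheory.cond`. -/
noncomputable def condP {Ω : Type*} [MeasurableSpace Ω] (μ : Measure Ω) (A B : Set Ω) : ℝ :=
  ((ProbabilityTheory.cond μ B) A).toReal

theorem condP_eq_div {Ω : Type*} [MeasurableSpace Ω] (μ : Measure Ω) (A : Set Ω) {B : Set Ω}
    (hB : MeasurableSet B) : condP μ A B = μ.real (B ∩ A) / μ.real B := by
  rw [condP, cond_apply hB, ENNReal.toReal_mul, ENNReal.toReal_inv, div_eq_inv_mul]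
  rfl

/-- Bayes' formula for the two hypotheses `C` and `Cᶜ`, given the background event `B`. -/
theorem condP_inter_eq_bayes {Ω : Type*} [MeasurableSpace Ω] (μ : Measure Ω) [IsFiniteMeasure μ]
    {R C B : Set Ω} (hR : MeasurableSet R) (hC : MeasurableSet C) (hB : MeasurableSet B)
    (hCB : 0 < μ (C ∩ B)) (hCcB : 0 < μ (Cᶜ ∩ B)) :
    condP μ C (R ∩ B) = condP μ R (C ∩ B) * condP μ C B /
      (condP μ R (C ∩ B) * condP μ C B + condP μ R (Cᶜ ∩ B) * (1 - condP μ C B)) := by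
  have pos {S : Set Ω} (h : 0 < μ S) : 0 < μ.real S :=
    ENNReal.toReal_pos h.ne' (measure_ne_top μ S)
  have hc := pos hCB
  have hc' := pos hCcB
  have hsplit : μ.real B = μ.real (C ∩ B) + μ.real (Cᶜ ∩ B) := by
    rw [← measureReal_inter_add_sdiff (s := B) hC, Set.inter_comm B C, Set.sdiff_eq,
      Set.inter_comm B Cᶜ]
  have hRsplit : μ.real (R ∩ B) = μ.real (C ∩ B ∩ R) + μ.real (Cᶜ ∩ B ∩ R) := by
    rw [← measureReal_inter_add_sdiff (s := R ∩ B) hC]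
    congr 2 <;> ext x <;> simp <;> tauto
  have hnum : R ∩ B ∩ C = C ∩ B ∩ R := by ext x; simp; tauto
  rw [condP_eq_div μ C (hR.inter hB), condP_eq_div μ R (hC.inter hB),
    condP_eq_div μ R (hC.compl.inter hB), condP_eq_div μ C hB, hnum, Set.inter_comm B C,
    hRsplit, hsplit]
  have hb : 0 < μ.real (C ∩ B) + μ.real (Cᶜ ∩ B) := by positivity
  generalize μ.real (C ∩ B) = c at *
  generalize μ.real (Cᶜ ∩ B) = d at *
  generalize μ.real (C ∩ B ∩ R) = x at *
  generalize μ.real (Cᶜ ∩ B ∩ R) = y at *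
  have h₁ : x / c * (c / (c + d)) = x / (c + d) := by field_simp
  have h₂ : y / d * (1 - c / (c + d)) = y / (c + d) := by field_simp; ring
  rw [h₁, h₂, ← add_div, div_div_div_cancel_right₀ hb.ne']

theorem stmt14 {Ω : Type*} [MeasurableSpace Ω] (μ : Measure Ω) [IsProbabilityMeasure μ]
    (R C Bmaj Bmin : Set Ω)
    (hRm : MeasurableSet R) (hCm : MeasurableSet C)
    (hBmajm : MeasurableSet Bmaj) (hBminm : MeasurableSet Bmin)
    (hBmaj : 0 < μ Bmaj) (hCBmaj : 0 < μ (C ∩ Bmaj)) (hCcBmaj : 0 < μ (Cᶜ ∩ Bmaj))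
    (hRBmaj : 0 < μ (R ∩ Bmaj))
    (hBmin : 0 < μ Bmin) (hCBmin : 0 < μ (C ∩ Bmin)) (hCcBmin : 0 < μ (Cᶜ ∩ Bmin))
    (hRBmin : 0 < μ (R ∩ Bmin))
    (hRcri : condP μ R (C ∩ Bmaj) = condP μ R (C ∩ Bmin))
    (hRinn : condP μ R (Cᶜ ∩ Bmaj) = condP μ R (Cᶜ ∩ Bmin))
    (hCD : condP μ C Bmaj = condP μ C Bmin) :
    condP μ C (R ∩ Bmaj) = condP μ C (R ∩ Bmin) := by
  rw [condP_inter_eq_bayes μ hRm hCm hBmajm hCBmaj hCcBmaj,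
    condP_inter_eq_bayes μ hRm hCm hBminm hCBmin hCcBmin, hRcri, hRinn, hCD]
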